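/- There exists a constant C > 0, depending only on β and N, such that for every n ≥ 1, E_{P_{n,β}}[W_n²] ≤ C. -/

import Mathlib

open MeasureTheory Real RealInnerProductSpace

noncomputable section

def besselRatio (N : ℕ) (x : ℝ) : ℝ :=
  x / ((N : ℝ) - 1) *
      (∫ θ in (0:ℝ)..π, Real.exp (x * Real.cos θ) * Real.sin θ ^ N) /
    ∫ θ in (0:ℝ)..π, Real.exp (x * Real.cos θ) * Real.sin θ ^ (N - 2)

/-- The unit sphere `S^{N-1}` in `ℝ^N`. -/
abbrev UnitSphere (N : ℕ) := Metric.sphere (0 : EuclideanSpace ℝ (Fin N)) 1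

/-- The map on the unit sphere induced by a linear isometry of `ℝ^N`. -/
def sphereMap {N : ℕ}
    (e : EuclideanSpace ℝ (Fin N) ≃ₗᵢ[ℝ] EuclideanSpace ℝ (Fin N))
    (θ : UnitSphere N) : UnitSphere N :=
  ⟨e θ, by
    rw [mem_sphere_zero_iff_norm, e.norm_map]
    exact mem_sphere_zero_iff_norm.mp θ.2⟩

/-- Total spin `S_n(σ) = ∑ i, σ_i`. -/
def totalSpin {N n : ℕ} (σ : Fin n → UnitSphere N) : EuclideanSpace ℝ (Fin N) :=
  ∑ i, (σ i : EuclideanSpace ℝ (Fin N))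

/-- `W_n(σ) = √n (β²/(n²b²) |S_n(σ)|² - 1)`. -/
def Wspin (N n : ℕ) (β b : ℝ) (σ : Fin n → UnitSphere N) : ℝ :=
  Real.sqrt n * (β ^ 2 / ((n : ℝ) ^ 2 * b ^ 2) * ‖totalSpin σ‖ ^ 2 - 1)

/-- The (unnormalized) Gibbs weight `exp((β/(2n)) ∑_i ∑_j ⟨σ_i, σ_j⟩)`. -/
def gibbsWeight (N n : ℕ) (β : ℝ) (σ : Fin n → UnitSphere N) : ℝ :=
  Real.exp (β / (2 * n) * ∑ i, ∑ j,
    ⟪(σ i : EuclideanSpace ℝ (Fin N)), (σ j : EuclideanSpace ℝ (Fin N))⟫)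

/-- The Gibbs measure `P_{n,β}` on `(S^{N-1})^n`. -/
def gibbsMeasure (N n : ℕ) (β : ℝ) (μ : Measure (UnitSphere N))
    [IsProbabilityMeasure μ] : Measure (Fin n → UnitSphere N) :=
  (Measure.pi fun _ : Fin n => μ).withDensity fun σ =>
    ENNReal.ofReal
      (gibbsWeight N n β σ / ∫ τ, gibbsWeight N n β τ ∂(Measure.pi fun _ : Fin n => μ))

end

lemma hasDerivAt_expInt {X : Type*} [MeasurableSpace X] (ν : Measure X) [IsFiniteMeasure ν]
    (G T : X → ℝ) (hG : Measurable G) (hT : Measurable T) (K : ℝ)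
    (hGb : ∀ x, |G x| ≤ K) (hTb : ∀ x, |T x| ≤ 1) (r : ℝ) :
    HasDerivAt (fun s => ∫ x, G x * Real.exp (s * T x) ∂ν)
      (∫ x, G x * T x * Real.exp (r * T x) ∂ν) r := by
  have hb : ∀ s x, Real.exp (s * T x) ≤ Real.exp |s| := by
    intro s x
    apply Real.exp_le_exp.2
    calc s * T x ≤ |s * T x| := le_abs_self _
      _ = |s| * |T x| := abs_mul _ _
      _ ≤ |s| * 1 := mul_le_mul_of_nonneg_left (hTb x) (abs_nonneg _)
      _ = |s| := mul_one _
  refine (hasDerivAt_integral_of_dominated_loc_of_deriv_le (μ := ν)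
    (F := fun s x => G x * Real.exp (s * T x))
    (F' := fun s x => G x * T x * Real.exp (s * T x))
    (bound := fun _ => K * 1 * Real.exp (|r| + 1)) (Metric.ball_mem_nhds r one_pos)
    ?_ ?_ ?_ ?_ ?_ ?_).2
  · exact Filter.Eventually.of_forall fun s => by
      apply Measurable.aestronglyMeasurable; fun_prop
  · refine Integrable.of_bound (C := K * Real.exp |r|) ?_ ?_
    · apply Measurable.aestronglyMeasurable; fun_prop
    · refine Filter.Eventually.of_forall fun x => ?_
      rw [Real.norm_eq_abs, abs_mul, abs_of_pos (Real.exp_pos _)]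
      have := abs_nonneg (G x)
      exact mul_le_mul (hGb x) (hb r x) (Real.exp_pos _).le (this.trans (hGb x))
  · apply Measurable.aestronglyMeasurable; fun_prop
  · refine Filter.Eventually.of_forall fun x s hs => ?_
    rw [Real.norm_eq_abs, abs_mul, abs_of_pos (Real.exp_pos _), abs_mul]
    have h0 := abs_nonneg (G x)
    have h1 : |s| ≤ |r| + 1 := by
      rw [Metric.mem_ball, Real.dist_eq] at hs
      have := abs_sub_abs_le_abs_sub s r
      linarith
    have hK := h0.trans (hGb x)
    refine mul_le_mul (mul_le_mul (hGb x) (hTb x) (abs_nonneg _) hK) ?_ (Real.exp_pos _).le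
      (by positivity)
    exact (hb s x).trans (Real.exp_le_exp.2 h1)
  · exact integrable_const _
  · refine Filter.Eventually.of_forall fun x s _ => ?_
    have := ((((hasDerivAt_id s).mul_const (T x)).exp).const_mul (G x))
    refine this.congr_deriv ?_
    simp only [id]; ring

/-- Comparison of log-derivatives of two solutions. -/
lemma wronskian (k : ℕ) (m m1 m2 J J1 J2 : ℝ → ℝ)
    (hm : ∀ r, HasDerivAt m (m1 r) r) (hm1 : ∀ r, HasDerivAt m1 (m2 r) r)
    (hJ : ∀ r, HasDerivAt J (J1 r) r) (hJ1 : ∀ r, HasDerivAt J1 (J2 r) r)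
    (ode : ∀ r, 0 ≤ r → r * m2 r = r * m r - (k + 1) * m1 r)
    (odeJ : ∀ r, 0 ≤ r → r * J2 r = r * J r - (k + 1) * J1 r) (b : ℝ) (hb : 0 < b) :
    m1 b * J b = m b * J1 b := by
  obtain ⟨c, hc, h⟩ := exists_hasDerivAt_eq_slope
    (fun r => r ^ (k+1) * (m1 r * J r - m r * J1 r)) _ hb
    (fun r _ => (((hasDerivAt_pow (k+1) r).mul (((hm1 r).mul (hJ r)).sub
      ((hm r).mul (hJ1 r)))).continuousAt).continuousWithinAt)
    (fun r _ => (hasDerivAt_pow (k+1) r).mul (((hm1 r).mul (hJ r)).sub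
      ((hm r).mul (hJ1 r))))
  have h1 := ode c hc.1.le
  have h2 := odeJ c hc.1.le
  have h3 : ((k+1 : ℕ) : ℝ) * c ^ (k+1-1) * (m1 c * J c - m c * J1 c) +
    c ^ (k+1) * (m2 c * J c + m1 c * J1 c - (m1 c * J1 c + m c * J2 c)) = 0 := by
    have : ((k+1 : ℕ) : ℝ) * c ^ (k+1-1) * (m1 c * J c - m c * J1 c) +
      c ^ (k+1) * (m2 c * J c + m1 c * J1 c - (m1 c * J1 c + m c * J2 c)) = c ^ k *
      ((k+1) * (m1 c * J c - m c * J1 c) + (c * m2 c) * J c - m c * (c * J2 c)) := by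
      push_cast; ring
    rw [this, h1, h2]; ring
  have h4 := h
  rw [show (((k+1 : ℕ) : ℝ) * c ^ (k+1-1) * (m1 c * J c - m c * J1 c) +
    c ^ (k+1) * (m2 c * J c + m1 c * J1 c - (m1 c * J1 c + m c * J2 c))) = 0 from h3] at h4
  have hb' : b ≠ 0 := hb.ne'
  field_simp at h4
  simp at h4
  rcases h4 with h4 | h4
  · exact absurd h4 hb'
  · linarith

/-- Strict monotonicity facts from the ODE. -/
lemma ode_facts (k : ℕ) (m m1 m2 : ℝ → ℝ)
    (hm : ∀ r, HasDerivAt m (m1 r) r) (hm1 : ∀ r, HasDerivAt m1 (m2 r) r)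
    (ode : ∀ r, 0 ≤ r → r * m2 r = r * m r - (k + 1) * m1 r) (hpos : ∀ r, 0 < m r) :
    ∀ r, 0 < r → 0 < (k + 2) * r ^ (k+1) * m r * m1 r + r ^ (k+2) * (m1 r ^ 2 - m r ^ 2) := by
  have hm1pos : ∀ r, 0 < r → 0 < m1 r := by
    intro r hr
    have hd : ∀ x, HasDerivAt (fun r => r ^ (k+1) * m1 r)
      (((k+1 : ℕ) : ℝ) * x ^ (k+1-1) * m1 x + x ^ (k+1) * m2 x) x :=
      fun x => (hasDerivAt_pow (k+1) x).mul (hm1 x)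
    obtain ⟨c, hc, h⟩ := exists_hasDerivAt_eq_slope (fun r => r ^ (k+1) * m1 r) _ hr
      (fun r _ => (hd r).continuousAt.continuousWithinAt) (fun x _ => hd x)
    have h1 := ode c hc.1.le
    have h2 : ((k+1 : ℕ) : ℝ) * c ^ (k+1-1) * m1 c + c ^ (k+1) * m2 c = c ^ (k+1) * m c := by
      have : ((k+1 : ℕ) : ℝ) * c ^ (k+1-1) * m1 c + c ^ (k+1) * m2 c =
        c ^ k * ((k+1) * m1 c + c * m2 c) := by
        push_cast; ring
      rw [this, h1]; ring
    rw [h2] at h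
    have h3 : 0 < c ^ (k+1) * m c := mul_pos (pow_pos hc.1 _) (hpos c)
    rw [h] at h3
    simp at h3
    have h4 : 0 < r ^ (k+1) * m1 r / r := h3
    rw [div_pos_iff_of_pos_right hr] at h4
    exact (pos_iff_pos_of_mul_pos h4).1 (pow_pos hr _)
  intro r hr
  have hd : ∀ x, HasDerivAt
      (fun r => (k + 2) * r ^ (k+1) * m r * m1 r + r ^ (k+2) * (m1 r ^ 2 - m r ^ 2))
      (((k + 2) * (((k+1 : ℕ) : ℝ) * x ^ (k+1-1)) * m x + (k + 2) * x ^ (k+1) * m1 x) * m1 x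
        + (k + 2) * x ^ (k+1) * m x * m2 x + (((k+2 : ℕ) : ℝ) * x ^ (k+2-1) * (m1 x ^ 2 - m x ^ 2)
        + x ^ (k+2) * (((2:ℕ):ℝ) * m1 x ^ (2-1) * m2 x - ((2:ℕ):ℝ) * m x ^ (2-1) * m1 x))) x :=
    fun x => ((((hasDerivAt_pow (k+1) x).const_mul ((k:ℝ)+2)).mul (hm x)).mul (hm1 x)).add
      ((hasDerivAt_pow (k+2) x).mul (((hm1 x).pow 2).sub ((hm x).pow 2)))
  obtain ⟨c, hc, h⟩ := exists_hasDerivAt_eq_slope _ _ hr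
      (fun r _ => (hd r).continuousAt.continuousWithinAt) (fun x _ => hd x)
  have h1 := ode c hc.1.le
  have h2 : (((k + 2) * (((k+1 : ℕ) : ℝ) * c ^ (k+1-1)) * m c + (k + 2) * c ^ (k+1) * m1 c) * m1 c
        + (k + 2) * c ^ (k+1) * m c * m2 c + (((k+2 : ℕ) : ℝ) * c ^ (k+2-1) * (m1 c ^ 2 - m c ^ 2)
        + c ^ (k+2) * (((2:ℕ):ℝ) * m1 c ^ (2-1) * m2 c - ((2:ℕ):ℝ) * m c ^ (2-1) * m1 c)))
        = 2 * c ^ (k+1) * m1 c ^ 2 := by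
    have : (((k + 2) * (((k+1 : ℕ) : ℝ) * c ^ (k+1-1)) * m c + (k + 2) * c ^ (k+1) * m1 c) * m1 c
        + (k + 2) * c ^ (k+1) * m c * m2 c + (((k+2 : ℕ) : ℝ) * c ^ (k+2-1) * (m1 c ^ 2 - m c ^ 2)
        + c ^ (k+2) * (((2:ℕ):ℝ) * m1 c ^ (2-1) * m2 c - ((2:ℕ):ℝ) * m c ^ (2-1) * m1 c)))
        = c ^ k * ((k+2) * (k+1) * m c * m1 c + (k+2) * c * m1 c ^ 2 + (k+2) * m c * (c * m2 c)
          + (k+2) * c * (m1 c ^ 2 - m c ^ 2) + 2 * c * m1 c * (c * m2 c) - 2 * c ^ 2 * m c * m1 c) := by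
      push_cast; ring
    rw [this, h1]; ring
  rw [h2] at h
  have h3 : 0 < 2 * c ^ (k+1) * m1 c ^ 2 := by
    have := hm1pos c hc.1
    have := hc.1
    positivity
  rw [h] at h3
  rw [div_pos_iff_of_pos_right (by linarith)] at h3
  simpa using h3

/-- Quantitative sign of the derivative of the rate function. -/
lemma rate_bound (k : ℕ) (m m1 m2 : ℝ → ℝ)
    (hm : ∀ r, HasDerivAt m (m1 r) r) (hm1 : ∀ r, HasDerivAt m1 (m2 r) r)
    (ode : ∀ r, 0 ≤ r → r * m2 r = r * m r - (k + 1) * m1 r) (hpos : ∀ r, 0 < m r)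
    (β b : ℝ) (hβ : 0 < β) (hb : 0 < b) (hfix : b * m b = β * m1 b) :
    ∃ c > 0, ∀ r, 0 < r → c * (r - b) ^ 2 * r ≤ (r / β - m1 r / m r) * (r - b) * (1 + r) := by
  have key := ode_facts k m m1 m2 hm hm1 ode hpos
  set g : ℝ → ℝ := fun r => m1 r / (r * m r) with hg
  have hgd : ∀ r, 0 < r → ∃ d < 0, HasDerivAt g d r := by
    intro r hr
    have hne : r * m r ≠ 0 := (mul_pos hr (hpos r)).ne'
    refine ⟨_, ?_, (hm1 r).div ((hasDerivAt_id r).mul (hm r)) hne⟩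
    apply div_neg_of_neg_of_pos
    · have h1 := ode r hr.le
      have h2 := key r hr
      have h3 : 0 < r ^ (k+1) * ((k + 2) * m r * m1 r + r * (m1 r ^ 2 - m r ^ 2)) := by
        calc _ < _ := h2
          _ = _ := by ring
      have h4 := (pos_iff_pos_of_mul_pos h3).1 (pow_pos hr _)
      simp only [id]
      have : m2 r * (r * m r) - m1 r * (1 * m r + r * m1 r) =
        (r * m2 r) * m r - m1 r * m r - r * m1 r ^ 2 := by ring
      rw [this, h1]; nlinarith
    · positivity
  have hanti : StrictAntiOn g (Set.Ioi 0) := by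
    apply strictAntiOn_of_deriv_neg (convex_Ioi 0)
    · intro x hx
      obtain ⟨d, _, h⟩ := hgd x hx
      exact h.continuousAt.continuousWithinAt
    · intro x hx
      rw [interior_Ioi] at hx
      obtain ⟨d, hd, h⟩ := hgd x hx
      rw [h.deriv]; exact hd
  have hgb : g b = 1 / β := by
    have := hpos b
    simp only [hg]; field_simp; linarith
  obtain ⟨d, hd, hdb⟩ := hgd b hb
  -- local bound
  have hloc : ∀ᶠ r in nhds b, |g r - g b - (r - b) * d| ≤ (-d/2) * |r - b| := by
    have := (hasDerivAt_iff_isLittleO.1 hdb).def (show 0 < -d/2 by linarith)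
    simpa [Real.norm_eq_abs] using this
  obtain ⟨δ, hδ, hball⟩ := Metric.eventually_nhds_iff.1 hloc
  obtain ⟨ε, hε, hεδ, hεb⟩ : ∃ ε > 0, ε < δ ∧ ε < b :=
    ⟨min δ b / 2, by positivity, by have := min_le_left δ b; have := lt_min hδ hb; linarith,
      by have := min_le_right δ b; have := lt_min hδ hb; linarith⟩
  have hd1 : 0 < g (b - ε) - g b := sub_pos.2 (hanti (by simp; linarith) hb (by linarith))
  have hd2 : 0 < g b - g (b + ε) := sub_pos.2 (hanti hb (by simp; linarith) (by linarith))
  -- main claim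
  suffices H : ∃ c > 0, ∀ r, 0 < r → c * (r - b) ^ 2 ≤ (g b - g r) * (r - b) * (1 + r) by
    obtain ⟨c, hc, h⟩ := H
    refine ⟨c, hc, fun r hr => ?_⟩
    have h1 := mul_le_mul_of_nonneg_right (h r hr) hr.le
    have h2 : (r / β - m1 r / m r) = (g b - g r) * r := by
      rw [hgb]; simp only [hg]; have := hpos r; field_simp
    rw [h2]; linarith
  refine ⟨min (-d/2) (min ((g (b - ε) - g b) / b) (g b - g (b + ε))), by
    refine lt_min (by linarith) (lt_min (by positivity) hd2), fun r hr => ?_⟩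
  set c := min (-d/2) (min ((g (b - ε) - g b) / b) (g b - g (b + ε))) with hc
  have c1 : c ≤ -d/2 := min_le_left _ _
  have c2 : c ≤ (g (b - ε) - g b) / b := (min_le_right _ _).trans (min_le_left _ _)
  have c3 : c ≤ g b - g (b + ε) := (min_le_right _ _).trans (min_le_right _ _)
  have c0 : 0 < c := lt_min (by linarith) (lt_min (by positivity) hd2)
  have hfin : ∀ y, c * (r-b)^2 ≤ y → c * (r-b)^2 ≤ y * (1+r) := by
    intro y hy
    have : 0 ≤ c * (r-b)^2 := by positivity
    nlinarith
  rcases lt_or_ge r (b - ε) with h | h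
  · apply hfin
    have h1 : g (b - ε) < g r := hanti hr (by simp; linarith) h
    rw [le_div_iff₀ hb] at c2
    have h2 : c * (b - r) ≤ g r - g b := by nlinarith
    nlinarith
  rcases lt_or_ge (b + ε) r with h' | h'
  · have h1 : g r < g (b + ε) := hanti (by simp; linarith) hr h'
    have h2 : c ≤ g b - g r := by linarith
    have h3 : c * (r - b) ≤ (g b - g r) * (1 + r) := by
      apply mul_le_mul h2 (by linarith) (by linarith) (by linarith)
    nlinarith
  · apply hfin
    have h1 : dist r b < δ := by
      rw [Real.dist_eq]; apply lt_of_le_of_lt _ hεδ; rw [abs_le]; constructor <;> linarith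
    have h2 := hball h1
    have h3 : |(g r - g b - (r - b) * d) * (r - b)| ≤ (-d/2) * (r - b)^2 := by
      rw [abs_mul]
      calc _ ≤ (-d/2) * |r - b| * |r - b| := mul_le_mul_of_nonneg_right h2 (abs_nonneg _)
        _ = (-d/2) * |r-b|^2 := by ring
        _ = _ := by rw [sq_abs]
    have h4 := (abs_le.1 h3).2
    have h5 : c * (r-b)^2 ≤ (-d/2) * (r-b)^2 := mul_le_mul_of_nonneg_right c1 (sq_nonneg _)
    nlinarith

lemma radial_bound (k : ℕ) (m m1 m2 : ℝ → ℝ)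
    (hm : ∀ r, HasDerivAt m (m1 r) r) (hm1 : ∀ r, HasDerivAt m1 (m2 r) r) (hpos : ∀ r, 0 < m r)
    (β b : ℝ) (hb : 0 < b) (c : ℝ) (hc : 0 < c)
    (hrate : ∀ r, 0 < r → c * (r - b) ^ 2 * r ≤ (r / β - m1 r / m r) * (r - b) * (1 + r)) :
    ∃ C > 0, ∀ n : ℕ, 1 ≤ n → ∀ R, b ≤ R →
      n * (∫ r in (0:ℝ)..R, r ^ (k+1) * ((r - b) ^ 2 * (Real.exp (-(n * r ^ 2 / (2 * β))) * m r ^ n)))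
      ≤ C * ∫ r in (0:ℝ)..R, r ^ (k+1) * (Real.exp (-(n * r ^ 2 / (2 * β))) * m r ^ n) := by
  refine ⟨(k + 2) * (1 + 4 / b) / c, by positivity, fun n hn R hR => ?_⟩
  set E : ℝ → ℝ := fun r => Real.exp (-(n * r ^ 2 / (2 * β))) * m r ^ n with hE
  have hEpos : ∀ r, 0 < E r := fun r => mul_pos (Real.exp_pos _) (pow_pos (hpos r) _)
  have hmc : Continuous m := continuous_iff_continuousAt.2 fun r => (hm r).continuousAt
  have hm1c : Continuous m1 := continuous_iff_continuousAt.2 fun r => (hm1 r).continuousAt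
  have hEc : Continuous E := by simp only [hE]; fun_prop
  have hEd : ∀ r, HasDerivAt E (n * E r * (m1 r / m r - r / β)) r := by
    intro r
    have h1 : HasDerivAt (fun r : ℝ => -(n * r ^ 2 / (2 * β))) (-(n * r / β)) r := by
      have := (((hasDerivAt_pow 2 r).const_mul (n:ℝ)).div_const (2 * β)).neg
      refine this.congr_deriv ?_
      push_cast
      rw [show (n:ℝ) * (2 * r ^ (2-1)) = 2 * (n * r) by ring, mul_div_mul_left _ _ two_ne_zero]
    refine (h1.exp.mul ((hm r).pow n)).congr_deriv ?_
    have h2 : m r ^ n = m r ^ (n-1) * m r := by rw [← pow_succ]; congr 1; omega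
    simp only [hE, Pi.pow_apply]
    rw [h2]
    have := hpos r
    field_simp
    ring
  have hIE : ∀ j : ℕ, ∀ x y : ℝ, IntervalIntegrable (fun r => r ^ j * E r) volume x y :=
    fun j x y => Continuous.intervalIntegrable (by fun_prop) _ _
  -- monotonicity
  have hmono : MonotoneOn E (Set.Icc 0 b) := by
    apply monotoneOn_of_deriv_nonneg (convex_Icc 0 b) hEc.continuousOn
    · intro x _; exact (hEd x).differentiableAt.differentiableWithinAt
    · intro x hx
      rw [interior_Icc] at hx
      rw [(hEd x).deriv]
      have h1 := hrate x hx.1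
      have h2 : 0 ≤ c * (x - b) ^ 2 * x := by have := hx.1; positivity
      have h3 : 0 ≤ m1 x / m x - x / β := by
        by_contra h
        push Not at h
        have h5 : (x / β - m1 x / m x) * (x - b) * (1 + x) < 0 := by
          apply mul_neg_of_neg_of_pos
          · apply mul_neg_of_pos_of_neg <;> linarith [hx.2]
          · linarith [hx.1]
        linarith
      have := (hEpos x).le
      positivity
  -- IBP
  set w : ℝ → ℝ := fun r => r ^ k * (r - b) * (1 + r) with hw
  have hwd : ∀ r, HasDerivAt w ((k * r ^ (k-1) * (r - b) + r ^ k * 1) * (1 + r)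
      + r ^ k * (r - b) * 1) r := by
    intro r
    exact ((hasDerivAt_pow k r).mul ((hasDerivAt_id r).sub_const b)).mul
      ((hasDerivAt_id r).const_add 1)
  set F' : ℝ → ℝ := fun r => ((k * r ^ (k-1) * (r - b) + r ^ k * 1) * (1 + r)
      + r ^ k * (r - b) * 1) * E r + w r * (n * E r * (m1 r / m r - r / β)) with hF'
  have hF'c : Continuous F' := by
    have h0 : ∀ r, m r ≠ 0 := fun r => (hpos r).ne'
    have : Continuous fun r => m1 r / m r := hm1c.div hmc h0
    simp only [hF', hw]
    fun_prop
  have hR0 : 0 ≤ R := hb.le.trans hR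
  have hftc : ∫ r in (0:ℝ)..R, F' r = w R * E R - w 0 * E 0 := by
    apply intervalIntegral.integral_eq_sub_of_hasDerivAt (f := fun r => w r * E r)
    · intro x _; exact (hwd x).mul (hEd x)
    · exact hF'c.intervalIntegrable _ _
  have hbd : 0 ≤ w R * E R - w 0 * E 0 := by
    have h1 : 0 ≤ w R := by
      simp only [hw]; have : 0 ≤ R - b := by linarith
      positivity
    have h2 : w 0 ≤ 0 := by
      simp only [hw]
      have : (0:ℝ) ≤ 0 ^ k := by positivity
      nlinarith
    have := (hEpos R).le
    have := (hEpos 0).le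
    nlinarith [mul_nonneg h1 (hEpos R).le]
  have hle : ∫ r in (0:ℝ)..R, F' r ≤ ∫ r in (0:ℝ)..R,
      ((k + 2) * (r ^ k * E r + r ^ (k+1) * E r) - (n * c) * (r ^ (k+1) * ((r - b) ^ 2 * E r))) := by
    apply intervalIntegral.integral_mono_on_of_le_Ioo hR0 (hF'c.intervalIntegrable _ _)
    · exact Continuous.intervalIntegrable (by fun_prop) _ _
    · intro r hr
      have hr0 := hr.1
      have h1 : (k:ℝ) * r ^ (k-1) * (r - b) ≤ k * r ^ k := by
        rcases Nat.eq_zero_or_pos k with h | h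
        · subst h; simp
        · have : r ^ k = r ^ (k-1) * r := by rw [← pow_succ]; congr 1; omega
          rw [this, mul_assoc]
          gcongr
          linarith
      have h2 : (k * r ^ (k-1) * (r - b) + r ^ k * 1) * (1 + r) + r ^ k * (r - b) * 1
          ≤ (k + 2) * (r ^ k + r ^ (k+1)) := by
        have h3 := mul_le_mul_of_nonneg_right h1 (show 0 ≤ 1 + r by linarith)
        have h4 : 0 < r ^ k := by positivity
        rw [pow_succ]
        nlinarith
      have h5 := mul_le_mul_of_nonneg_right h2 (hEpos r).le
      have h6 := mul_le_mul_of_nonneg_left (hrate r hr0)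
        (show 0 ≤ r ^ k * (n * E r) by have := (hEpos r).le; positivity)
      simp only [hF', hw]
      calc _ ≤ (k + 2) * (r ^ k + r ^ (k+1)) * E r
            - r ^ k * (n * E r) * ((r / β - m1 r / m r) * (r - b) * (1 + r)) := by linarith
        _ ≤ (k + 2) * (r ^ k + r ^ (k+1)) * E r - r ^ k * (n * E r) * (c * (r - b) ^ 2 * r) := by
            linarith
        _ = _ := by ring
  rw [hftc, intervalIntegral.integral_sub, intervalIntegral.integral_const_mul,
    intervalIntegral.integral_const_mul, intervalIntegral.integral_add (hIE _ _ _) (hIE _ _ _)] at hle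
  rotate_left
  · exact Continuous.intervalIntegrable (by fun_prop) _ _
  · exact Continuous.intervalIntegrable (by fun_prop) _ _
  -- small r
  have hb2 : 0 < b / 2 := by linarith
  have hI2 : (∫ r in (b/2)..R, r ^ k * E r) ≤ 2 / b * ∫ r in (b/2)..R, r ^ (k+1) * E r := by
    rw [← intervalIntegral.integral_const_mul]
    apply intervalIntegral.integral_mono_on (by linarith) (hIE _ _ _) ((hIE _ _ _).const_mul _)
    intro r hr
    have h0 : 0 < r := hb2.trans_le hr.1
    have h1 : 1 ≤ 2 / b * r := by
      rw [div_mul_eq_mul_div, le_div_iff₀ hb]; linarith [hr.1]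
    have := hEpos r
    calc r ^ k * E r = r ^ k * E r * 1 := by ring
      _ ≤ r ^ k * E r * (2 / b * r) := by gcongr
      _ = _ := by ring
  have hI1 : (∫ r in (0:ℝ)..(b/2), r ^ k * E r) ≤ (b/2) ^ (k+1) * E (b/2) := by
    have : (∫ r in (0:ℝ)..(b/2), r ^ k * E r) ≤ ∫ r in (0:ℝ)..(b/2), (b/2) ^ k * E (b/2) := by
      apply intervalIntegral.integral_mono_on hb2.le (hIE _ _ _) (by simp)
      intro r hr
      have h1 : E r ≤ E (b/2) := hmono ⟨hr.1, by linarith [hr.2]⟩ ⟨hb2.le, by linarith⟩ hr.2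
      have := hr.1
      have := (hEpos r).le
      exact mul_le_mul (pow_le_pow_left₀ hr.1 hr.2 k) h1 this (by positivity)
    rw [intervalIntegral.integral_const] at this
    refine this.trans_eq ?_
    simp; ring
  have hI3 : (b/2) ^ (k+1) * E (b/2) * (b/2) ≤ ∫ r in (b/2)..b, r ^ (k+1) * E r := by
    have : ∫ r in (b/2)..b, (b/2) ^ (k+1) * E (b/2) ≤ ∫ r in (b/2)..b, r ^ (k+1) * E r := by
      apply intervalIntegral.integral_mono_on (by linarith) (by simp) (hIE _ _ _)
      intro r hr
      have h1 : E (b/2) ≤ E r := hmono ⟨hb2.le, by linarith⟩ ⟨by linarith [hr.1], hr.2⟩ hr.1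
      have := (hEpos (b/2)).le
      have h3 : 0 ≤ r := by linarith [hr.1]
      exact mul_le_mul (pow_le_pow_left₀ hb2.le hr.1 _) h1 this (by positivity)
    rw [intervalIntegral.integral_const] at this
    refine le_trans (le_of_eq ?_) this
    simp; ring
  have hnn : ∀ x y, 0 ≤ x → x ≤ y → 0 ≤ ∫ r in x..y, r ^ (k+1) * E r := by
    intro x y hx hxy
    apply intervalIntegral.integral_nonneg hxy
    intro r hr
    have := (hEpos r).le
    have : 0 ≤ r := hx.trans hr.1
    positivity
  have s1 := intervalIntegral.integral_add_adjacent_intervals (hIE k 0 (b/2)) (hIE k (b/2) R)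
  have s2 := intervalIntegral.integral_add_adjacent_intervals (hIE (k+1) 0 (b/2)) (hIE (k+1) (b/2) R)
  have s3 := intervalIntegral.integral_add_adjacent_intervals (hIE (k+1) (b/2) b) (hIE (k+1) b R)
  have n1 := hnn 0 (b/2) le_rfl hb2.le
  have n2 := hnn b R hb.le hR
  have n3 := hnn (b/2) R hb2.le (by linarith)
  set A := ∫ r in (0:ℝ)..R, r ^ (k+1) * E r with hA
  set B := ∫ r in (0:ℝ)..R, r ^ (k+1) * ((r - b) ^ 2 * E r) with hB
  have hsm : (∫ r in (0:ℝ)..R, r ^ k * E r) ≤ 4 / b * A := by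
    have h1 : (b/2) ^ (k+1) * E (b/2) ≤ 2 / b * A := by
      have h9 : (b/2) ^ (k+1) * E (b/2) * (b/2) ≤ A := by linarith
      rw [div_mul_eq_mul_div, le_div_iff₀ hb]; linarith
    have h2 : 2 / b * (∫ r in (b/2)..R, r ^ (k+1) * E r) ≤ 2 / b * A := by
      apply mul_le_mul_of_nonneg_left _ (by positivity); linarith
    have h3 : 4 / b * A = 2 / b * A + 2 / b * A := by ring
    linarith
  have hfin : n * c * B ≤ (k + 2) * (4 / b * A + A) := by
    have : ((k:ℝ) + 2) * ((∫ r in (0:ℝ)..R, r ^ k * E r) + A) ≤ (k + 2) * (4 / b * A + A) := by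
      gcongr
    linarith
  rw [div_mul_eq_mul_div, le_div_iff₀ hc]
  linarith

lemma polar_bound (k : ℕ) (E : ℝ → ℝ) (b C n : ℝ)
    (h1 : Integrable (fun x : EuclideanSpace ℝ (Fin (k+2)) => E ‖x‖))
    (h2 : Integrable (fun x : EuclideanSpace ℝ (Fin (k+2)) => (‖x‖ - b) ^ 2 * E ‖x‖))
    (h : ∀ R, b ≤ R → n * (∫ r in (0:ℝ)..R, r ^ (k+1) * ((r - b) ^ 2 * E r))
      ≤ C * ∫ r in (0:ℝ)..R, r ^ (k+1) * E r) :
    n * (∫ x : EuclideanSpace ℝ (Fin (k+2)), (‖x‖ - b) ^ 2 * E ‖x‖)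
      ≤ C * ∫ x : EuclideanSpace ℝ (Fin (k+2)), E ‖x‖ := by
  have e1 := integral_fun_norm_addHaar (volume : Measure (EuclideanSpace ℝ (Fin (k+2)))) E
  have e2 := integral_fun_norm_addHaar (volume : Measure (EuclideanSpace ℝ (Fin (k+2))))
    (fun r => (r - b) ^ 2 * E r)
  have i1 := (integrable_fun_norm_addHaar (volume : Measure (EuclideanSpace ℝ (Fin (k+2))))
    (f := E)).1 h1
  have i2 := (integrable_fun_norm_addHaar (volume : Measure (EuclideanSpace ℝ (Fin (k+2))))
    (f := fun r => (r - b) ^ 2 * E r)).1 h2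
  simp only [finrank_euclideanSpace, Fintype.card_fin, show k + 2 - 1 = k + 1 from rfl,
    smul_eq_mul, nsmul_eq_mul] at e1 e2 i1 i2
  have t1 := intervalIntegral_tendsto_integral_Ioi 0 i1 Filter.tendsto_id
  have t2 := intervalIntegral_tendsto_integral_Ioi 0 i2 Filter.tendsto_id
  have hlim := le_of_tendsto_of_tendsto (t2.const_mul n) (t1.const_mul C)
    (Filter.eventually_atTop.2 ⟨b, fun R hR => h R hR⟩)
  rw [e1, e2]
  have hnn : 0 ≤ ((k + 2 : ℕ) : ℝ) * (volume : Measure (EuclideanSpace ℝ (Fin (k+2)))).real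
    (Metric.ball 0 1) := by positivity
  have := mul_le_mul_of_nonneg_left hlim hnn
  calc _ = _ := by ring
    _ ≤ _ := this
    _ = _ := by ring

/-- Exponential moments of one coordinate. -/
noncomputable def mom {N : ℕ} (μ : Measure (UnitSphere N)) (i : Fin N) (p : ℕ) (r : ℝ) : ℝ :=
  ∫ σ : UnitSphere N, (σ.1 i) ^ p * Real.exp (r * σ.1 i) ∂μ

lemma coord_abs_le {N : ℕ} (σ : UnitSphere N) (i : Fin N) : |σ.1 i| ≤ 1 := by
  have h1 : ‖σ.1‖ = 1 := mem_sphere_zero_iff_norm.mp σ.2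
  have := PiLp.norm_apply_le σ.1 i
  rw [h1] at this
  exact this

lemma coord_meas {N : ℕ} (i : Fin N) : Measurable fun σ : UnitSphere N => σ.1 i := by
  have : Continuous fun σ : UnitSphere N => σ.1 i := by fun_prop
  exact this.measurable

lemma mom_hasDerivAt {N : ℕ} (μ : Measure (UnitSphere N)) [IsProbabilityMeasure μ] (i : Fin N)
    (p : ℕ) (r : ℝ) : HasDerivAt (mom μ i p) (mom μ i (p+1) r) r := by
  have := hasDerivAt_expInt μ (fun σ => (σ.1 i) ^ p) (fun σ => σ.1 i) ((coord_meas i).pow_const p)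
    (coord_meas i) 1 (fun σ => by
      rw [abs_pow]; exact pow_le_one₀ (abs_nonneg _) (coord_abs_le σ i)) (fun σ => coord_abs_le σ i) r
  refine this.congr_deriv ?_
  simp only [mom, pow_succ]

lemma int_bdd {N : ℕ} (μ : Measure (UnitSphere N)) [IsProbabilityMeasure μ]
    (f : UnitSphere N → ℝ) (hf : Continuous f) : Integrable f μ := by
  obtain ⟨C, hC⟩ := isCompact_univ.exists_bound_of_continuousOn (hf.continuousOn (s := Set.univ))
  exact Integrable.of_bound hf.aestronglyMeasurable C (Filter.Eventually.of_forall fun x => hC x trivial)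

lemma mom_zero_pos {N : ℕ} (μ : Measure (UnitSphere N)) [IsProbabilityMeasure μ] (i : Fin N)
    (r : ℝ) : 0 < mom μ i 0 r := by
  simp only [mom, pow_zero, one_mul]
  apply integral_exp_pos
  exact int_bdd μ _ (by fun_prop)

lemma radial {N : ℕ} (μ : Measure (UnitSphere N)) [IsProbabilityMeasure μ]
    (hμinv : ∀ e : EuclideanSpace ℝ (Fin N) ≃ₗᵢ[ℝ] EuclideanSpace ℝ (Fin N),
      Measure.map (sphereMap e) μ = μ) (i : Fin N) (x : EuclideanSpace ℝ (Fin N)) :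
    ∫ σ : UnitSphere N, Real.exp ⟪x, σ.1⟫ ∂μ = mom μ i 0 ‖x‖ := by
  set y : EuclideanSpace ℝ (Fin N) := EuclideanSpace.single i ‖x‖ with hy
  have hn : ‖x‖ = ‖y‖ := by simp [hy]
  set e := Submodule.reflection (ℝ ∙ (x - y))ᗮ with he
  have hex : e x = y := Submodule.reflection_sub hn
  have hmeas : Measurable (sphereMap e) := by
    have : Continuous (sphereMap e) := by
      unfold sphereMap
      exact Continuous.subtype_mk (e.continuous.comp continuous_subtype_val) _
    exact this.measurable
  have h1 : ∫ σ : UnitSphere N, Real.exp ⟪y, σ.1⟫ ∂μ = ∫ σ : UnitSphere N, Real.exp ⟪x, σ.1⟫ ∂μ := by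
    conv_lhs => rw [← hμinv e]
    rw [integral_map hmeas.aemeasurable]
    · congr 1; ext σ
      simp only [sphereMap]
      rw [← hex, LinearIsometryEquiv.inner_map_map]
    · have : Continuous fun σ : UnitSphere N => Real.exp ⟪y, σ.1⟫ := by fun_prop
      exact this.aestronglyMeasurable
  rw [← h1]
  simp only [mom, pow_zero, one_mul]
  congr 1; ext σ
  congr 1
  simp [hy, EuclideanSpace.inner_single_left, mul_comm]

lemma mom_cross {N : ℕ} (μ : Measure (UnitSphere N)) [IsProbabilityMeasure μ]
    (hμinv : ∀ e : EuclideanSpace ℝ (Fin N) ≃ₗᵢ[ℝ] EuclideanSpace ℝ (Fin N),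
      Measure.map (sphereMap e) μ = μ) (i j : Fin N) (hij : j ≠ i) (r : ℝ) (hr : 0 < r) :
    ∫ σ : UnitSphere N, (σ.1 j) ^ 2 * Real.exp (r * σ.1 i) ∂μ = mom μ i 1 r / r := by
  have hb : ∀ σ : UnitSphere N, |Real.exp (r * σ.1 i)| ≤ Real.exp r := by
    intro σ
    rw [abs_of_pos (Real.exp_pos _)]
    apply Real.exp_le_exp.2
    have := (abs_le.1 (coord_abs_le σ i)).2
    nlinarith
  have hGm : Measurable fun σ : UnitSphere N => Real.exp (r * σ.1 i) := by
    have := coord_meas i; fun_prop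
  have hjm := coord_meas j
  have hd1 := hasDerivAt_expInt μ (fun σ => Real.exp (r * σ.1 i)) (fun σ => σ.1 j) hGm hjm
    (Real.exp r) hb (fun σ => coord_abs_le σ j)
  have hd2 := hasDerivAt_expInt μ (fun σ => Real.exp (r * σ.1 i) * σ.1 j) (fun σ => σ.1 j)
    (hGm.mul hjm) hjm
    (Real.exp r) (fun σ => by
      rw [abs_mul]
      calc _ ≤ Real.exp r * 1 := mul_le_mul (hb σ) (coord_abs_le σ j) (abs_nonneg _) (Real.exp_pos _).le
        _ = _ := mul_one _) (fun σ => coord_abs_le σ j)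
  have hpos : ∀ t : ℝ, 0 < r ^ 2 + t ^ 2 := fun t => by positivity
  have hsq : ∀ t : ℝ, HasDerivAt (fun t => √(r ^ 2 + t ^ 2)) (t / √(r ^ 2 + t ^ 2)) t := by
    intro t
    have h1 : HasDerivAt (fun t : ℝ => r ^ 2 + t ^ 2) (2 * t) t := by
      refine ((hasDerivAt_pow 2 t).const_add (r ^ 2)).congr_deriv ?_
      simp
    refine (h1.sqrt (hpos t).ne').congr_deriv ?_
    rw [mul_div_mul_left _ _ two_ne_zero]
  have heq : (fun t => ∫ σ : UnitSphere N, Real.exp (r * σ.1 i) * Real.exp (t * σ.1 j) ∂μ)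
      = fun t => mom μ i 0 (√(r ^ 2 + t ^ 2)) := by
    ext t
    set x : EuclideanSpace ℝ (Fin N) := EuclideanSpace.single i r + EuclideanSpace.single j t with hx
    have hxn : ‖x‖ = √(r ^ 2 + t ^ 2) := by
      have : ‖x‖ ^ 2 = r ^ 2 + t ^ 2 := by
        rw [hx, norm_add_sq_real]
        simp [EuclideanSpace.inner_single_left, hij.symm]
      rw [← this, Real.sqrt_sq (norm_nonneg _)]
    rw [← hxn, ← radial μ hμinv i x]
    congr 1; ext σ
    rw [← Real.exp_add, hx, inner_add_left]
    congr 1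
    simp [EuclideanSpace.inner_single_left, mul_comm]
  have hD : (fun t => ∫ σ : UnitSphere N, Real.exp (r * σ.1 i) * σ.1 j * Real.exp (t * σ.1 j) ∂μ)
      = fun t => (mom μ i 1 (√(r ^ 2 + t ^ 2)) / √(r ^ 2 + t ^ 2)) * t := by
    ext t
    have h1 := hd1 t
    rw [heq] at h1
    have h2 := (mom_hasDerivAt μ i 0 (√(r ^ 2 + t ^ 2))).comp t (hsq t)
    have := h1.unique h2
    rw [this]; ring
  have h1 := hd2 0
  rw [hD] at h1
  have hne : √(r ^ 2 + 0 ^ 2) ≠ 0 := (Real.sqrt_pos.2 (hpos 0)).ne'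
  have h2 := (((mom_hasDerivAt μ i 1 (√(r ^ 2 + 0 ^ 2))).comp 0 (hsq 0)).div (hsq 0) hne).mul
    (hasDerivAt_id (0:ℝ))
  have h3 := h1.unique h2
  simp only [id, mul_zero, zero_add, mul_one, zero_mul, Real.exp_zero, Function.comp, Pi.div_apply] at h3
  rw [show √(r ^ 2 + 0 ^ 2) = r by rw [zero_pow two_ne_zero, add_zero, Real.sqrt_sq hr.le]] at h3
  rw [← h3]
  congr 1; ext σ; ring

lemma mom_ode (k : ℕ) (μ : Measure (UnitSphere (k+2))) [IsProbabilityMeasure μ]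
    (hμinv : ∀ e : EuclideanSpace ℝ (Fin (k+2)) ≃ₗᵢ[ℝ] EuclideanSpace ℝ (Fin (k+2)),
      Measure.map (sphereMap e) μ = μ) (i : Fin (k+2)) (r : ℝ) (hr : 0 ≤ r) :
    r * mom μ i 2 r = r * mom μ i 0 r - (k + 1) * mom μ i 1 r := by
  rcases hr.eq_or_lt with h | hr
  · subst h
    have hev : ∀ r, mom μ i 0 (-r) = mom μ i 0 r := by
      intro r
      have h1 := radial μ hμinv i (EuclideanSpace.single i r)
      have h2 := radial μ hμinv i (EuclideanSpace.single i (-r))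
      have h3 : ‖(EuclideanSpace.single i r : EuclideanSpace ℝ (Fin (k+2)))‖ =
        ‖(EuclideanSpace.single i (-r) : EuclideanSpace ℝ (Fin (k+2)))‖ := by simp
      have h4 : ∀ r, ∫ σ : UnitSphere (k+2), Real.exp ⟪EuclideanSpace.single i r, σ.1⟫ ∂μ
          = mom μ i 0 r := by
        intro r
        simp only [mom, pow_zero, one_mul]
        congr 1; ext σ
        congr 1
        simp [EuclideanSpace.inner_single_left, mul_comm]
      rw [← h4, h2, ← h3, ← h1, h4]
    have h1 := mom_hasDerivAt μ i 0 0
    have h2 : HasDerivAt (fun r => mom μ i 0 (-r)) (mom μ i 1 (-0) * -1) 0 :=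
      (mom_hasDerivAt μ i 0 (-0)).comp (0:ℝ) (hasDerivAt_neg 0)
    rw [funext hev] at h2
    have := h1.unique h2
    simp only [neg_zero, zero_add] at this
    have : mom μ i 1 0 = 0 := by linarith
    simp [this]
  · have hs : ∀ σ : UnitSphere (k+2), (σ.1 i) ^ 2 + ∑ j ∈ Finset.univ.erase i, (σ.1 j) ^ 2 = 1 := by
      intro σ
      rw [Finset.add_sum_erase _ (fun j => (σ.1 j) ^ 2) (Finset.mem_univ i)]
      have h1 : ‖σ.1‖ = 1 := mem_sphere_zero_iff_norm.mp σ.2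
      have h2 := EuclideanSpace.real_norm_sq_eq σ.1
      rw [h1] at h2
      linarith
    have h1 : mom μ i 0 r = mom μ i 2 r + ∑ j ∈ Finset.univ.erase i,
        ∫ σ : UnitSphere (k+2), (σ.1 j) ^ 2 * Real.exp (r * σ.1 i) ∂μ := by
      rw [← integral_finsetSum _ (fun j _ => int_bdd μ _ (by fun_prop))]
      simp only [mom]
      rw [← integral_add (int_bdd μ _ (by fun_prop)) (int_bdd μ _ (by fun_prop))]
      congr 1; ext σ
      rw [← Finset.sum_mul, ← add_mul, hs σ, pow_zero]
    rw [Finset.sum_congr rfl (fun j hj => mom_cross μ hμinv i j (Finset.ne_of_mem_erase hj) r hr)] at h1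
    simp at h1
    rw [h1]
    field_simp
    ring

/-- The fixed-point equation in terms of the sphere moments. -/
lemma mom_fix (k : ℕ) (μ : Measure (UnitSphere (k+2))) [IsProbabilityMeasure μ]
    (hμinv : ∀ e : EuclideanSpace ℝ (Fin (k+2)) ≃ₗᵢ[ℝ] EuclideanSpace ℝ (Fin (k+2)),
      Measure.map (sphereMap e) μ = μ) (i : Fin (k+2)) (β b : ℝ) (hb : 0 < b)
    (hfix : b = β * besselRatio (k+2) b) :
    b * mom μ i 0 b = β * mom μ i 1 b := by
  set J : ℕ → ℝ → ℝ := fun p r => ∫ θ in (0:ℝ)..π, Real.sin θ ^ k * Real.cos θ ^ p * Real.exp (r * Real.cos θ)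
    with hJ
  have hJd : ∀ p r, HasDerivAt (J p) (J (p+1) r) r := by
    intro p r
    have := hasDerivAt_expInt (volume.restrict (Set.Ioc 0 π))
      (fun θ => Real.sin θ ^ k * Real.cos θ ^ p) Real.cos (by fun_prop) (by fun_prop) 1
      (fun θ => by
        rw [abs_mul, abs_pow, abs_pow]
        exact mul_le_one₀ (pow_le_one₀ (abs_nonneg _) (Real.abs_sin_le_one θ)) (by positivity)
          (pow_le_one₀ (abs_nonneg _) (Real.abs_cos_le_one θ)))
      Real.abs_cos_le_one r
    simp only [hJ, intervalIntegral.integral_of_le pi_pos.le]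
    refine this.congr_deriv ?_
    congr 1; ext θ; ring
  have hibp : ∀ r, (k + 1) * J 1 r = r * ∫ θ in (0:ℝ)..π, Real.exp (r * Real.cos θ) * Real.sin θ ^ (k+2) := by
    intro r
    have hd : ∀ θ, HasDerivAt (fun θ => Real.sin θ ^ (k+1) * Real.exp (r * Real.cos θ))
        ((k + 1) * (Real.sin θ ^ k * Real.cos θ ^ 1 * Real.exp (r * Real.cos θ))
          - r * (Real.exp (r * Real.cos θ) * Real.sin θ ^ (k+2))) θ := by
      intro θ
      refine (((Real.hasDerivAt_sin θ).pow (k+1)).mul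
        (((Real.hasDerivAt_cos θ).const_mul r).exp)).congr_deriv ?_
      simp only [Pi.pow_apply, Nat.add_sub_cancel]
      push_cast; ring
    have := intervalIntegral.integral_eq_sub_of_hasDerivAt (a := 0) (b := π) (fun θ _ => hd θ)
      (Continuous.intervalIntegrable (by fun_prop) _ _)
    rw [intervalIntegral.integral_sub, intervalIntegral.integral_const_mul,
      intervalIntegral.integral_const_mul] at this
    · simp at this
      simp only [hJ, pow_one]
      linarith
    · exact Continuous.intervalIntegrable (by fun_prop) _ _
    · exact Continuous.intervalIntegrable (by fun_prop) _ _
  have hJ2 : ∀ r, J 2 r = J 0 r - ∫ θ in (0:ℝ)..π, Real.exp (r * Real.cos θ) * Real.sin θ ^ (k+2) := by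
    intro r
    simp only [hJ]
    rw [← intervalIntegral.integral_sub]
    · apply intervalIntegral.integral_congr
      intro θ _
      simp only
      have := Real.sin_sq_add_cos_sq θ
      have : Real.cos θ ^ 2 = 1 - Real.sin θ ^ 2 := by linarith
      rw [this]; ring
    · exact Continuous.intervalIntegrable (by fun_prop) _ _
    · exact Continuous.intervalIntegrable (by fun_prop) _ _
  have hode : ∀ r, 0 ≤ r → r * J 2 r = r * J 0 r - (k + 1) * J 1 r := by
    intro r _
    rw [hJ2, hibp]; ring
  have hw := wronskian k (mom μ i 0) (mom μ i 1) (mom μ i 2) (J 0) (J 1) (J 2)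
    (mom_hasDerivAt μ i 0) (mom_hasDerivAt μ i 1) (hJd 0) (hJd 1)
    (fun r hr => mom_ode k μ hμinv i r hr) hode b hb
  have hJpos : 0 < J 0 b := by
    simp only [hJ, pow_zero, mul_one]
    apply intervalIntegral.intervalIntegral_pos_of_pos_on
    · exact Continuous.intervalIntegrable (by fun_prop) _ _
    · intro θ hθ
      have := Real.sin_pos_of_pos_of_lt_pi hθ.1 hθ.2
      positivity
    · exact pi_pos
  have hbr : besselRatio (k+2) b = J 1 b / J 0 b := by
    have hJ0 : J 0 b = ∫ θ in (0:ℝ)..π, Real.exp (b * Real.cos θ) * Real.sin θ ^ (k + 2 - 2) := by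
      simp only [hJ, pow_zero, mul_one, Nat.add_sub_cancel]
      congr 1; ext θ; ring
    unfold besselRatio
    rw [← hJ0]
    congr 1
    have := hibp b
    have hk : ((k + 2 : ℕ) : ℝ) - 1 = k + 1 := by push_cast; ring
    rw [hk]
    have : (k:ℝ) + 1 ≠ 0 := by positivity
    field_simp
    linarith
  rw [hbr] at hfix
  have h1 : b * J 0 b = β * J 1 b := by
    field_simp at hfix; linarith
  have h2 : J 0 b * (b * mom μ i 0 b - β * mom μ i 1 b) = 0 := by
    calc _ = (b * J 0 b) * mom μ i 0 b - β * (mom μ i 1 b * J 0 b) := by ring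
      _ = 0 := by rw [h1, hw]; ring
  rcases mul_eq_zero.1 h2 with h | h
  · exact absurd h hJpos.ne'
  · linarith

lemma gauss_integrable (N : ℕ) (a : ℝ) (ha : 0 < a) :
    Integrable (fun x : EuclideanSpace ℝ (Fin N) => Real.exp (-a * ‖x‖ ^ 2)) := by
  apply Integrable.of_integral_ne_zero
  rw [GaussianFourier.integral_rexp_neg_mul_sq_norm ha]
  have := pi_pos
  positivity

lemma gauss_second (N : ℕ) (a : ℝ) (ha : 0 < a) :
    Integrable (fun x : EuclideanSpace ℝ (Fin N) => ‖x‖ ^ 2 * Real.exp (-a * ‖x‖ ^ 2)) ∧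
    ∫ x : EuclideanSpace ℝ (Fin N), ‖x‖ ^ 2 * Real.exp (-a * ‖x‖ ^ 2) ≤
      2 / a * 2 ^ ((N:ℝ) / 2) * ∫ x : EuclideanSpace ℝ (Fin N), Real.exp (-a * ‖x‖ ^ 2) := by
  have hpt : ∀ x : EuclideanSpace ℝ (Fin N), ‖x‖ ^ 2 * Real.exp (-a * ‖x‖ ^ 2) ≤
      2 / a * Real.exp (-(a/2) * ‖x‖ ^ 2) := by
    intro x
    have h1 : a / 2 * ‖x‖ ^ 2 ≤ Real.exp (a / 2 * ‖x‖ ^ 2) := by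
      have := Real.add_one_le_exp (a / 2 * ‖x‖ ^ 2); linarith
    have h2 : ‖x‖ ^ 2 ≤ 2 / a * Real.exp (a / 2 * ‖x‖ ^ 2) := by
      rw [div_mul_eq_mul_div, le_div_iff₀ ha]; linarith
    calc _ ≤ 2 / a * Real.exp (a / 2 * ‖x‖ ^ 2) * Real.exp (-a * ‖x‖ ^ 2) :=
          mul_le_mul_of_nonneg_right h2 (Real.exp_pos _).le
      _ = 2 / a * Real.exp (-(a/2) * ‖x‖ ^ 2) := by
          rw [mul_assoc, ← Real.exp_add]; congr 2; ring
  have hi : Integrable (fun x : EuclideanSpace ℝ (Fin N) => ‖x‖ ^ 2 * Real.exp (-a * ‖x‖ ^ 2)) := by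
    refine ((gauss_integrable N (a/2) (by positivity)).const_mul (2/a)).mono'
      (Continuous.aestronglyMeasurable (by fun_prop)) (Filter.Eventually.of_forall fun x => ?_)
    rw [Real.norm_of_nonneg (by positivity)]
    exact hpt x
  refine ⟨hi, ?_⟩
  refine (integral_mono hi ((gauss_integrable N (a/2) (by positivity)).const_mul (2/a)) hpt).trans ?_
  rw [integral_const_mul, GaussianFourier.integral_rexp_neg_mul_sq_norm ha,
    GaussianFourier.integral_rexp_neg_mul_sq_norm (by positivity : 0 < a/2)]
  apply le_of_eq
  simp only [finrank_euclideanSpace, Fintype.card_fin]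
  rw [mul_assoc, ← Real.mul_rpow (by norm_num) (by positivity)]
  congr 2
  field_simp

lemma totalSpin_norm_le {N n : ℕ} (σ : Fin n → UnitSphere N) : ‖totalSpin σ‖ ≤ n := by
  unfold totalSpin
  refine (norm_sum_le _ _).trans ?_
  have : ∀ i, ‖(σ i : EuclideanSpace ℝ (Fin N))‖ = 1 := fun i => mem_sphere_zero_iff_norm.mp (σ i).2
  simp

lemma totalSpin_cont {N n : ℕ} : Continuous (totalSpin : (Fin n → UnitSphere N) → _) := by
  unfold totalSpin
  fun_prop

lemma gibbsWeight_eq {N n : ℕ} (β : ℝ) (σ : Fin n → UnitSphere N) :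
    gibbsWeight N n β σ = Real.exp (β / (2 * n) * ‖totalSpin σ‖ ^ 2) := by
  unfold gibbsWeight
  rw [← real_inner_self_eq_norm_sq]
  unfold totalSpin
  rw [sum_inner]
  simp only [inner_sum]

lemma integrable_joint {N n : ℕ} (P : Measure (Fin n → UnitSphere N)) [IsProbabilityMeasure P]
    (a L : ℝ) (ha : 0 < a) (f : (Fin n → UnitSphere N) × EuclideanSpace ℝ (Fin N) → ℝ)
    (hf : Continuous f) (hb : ∀ p, |f p| ≤ L * Real.exp (-a * ‖p.2‖ ^ 2)) :
    Integrable f (P.prod volume) := by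
  have h1 := ((gauss_integrable N a ha).const_mul L).comp_snd P
  exact h1.mono' hf.aestronglyMeasurable (Filter.Eventually.of_forall hb)

lemma HS_bound (k n : ℕ) (hn : 1 ≤ n) (P : Measure (Fin n → UnitSphere (k+2)))
    [IsProbabilityMeasure P] (β b C : ℝ) (hβ : 0 < β) (E : ℝ → ℝ)
    (hE : ∀ x : EuclideanSpace ℝ (Fin (k+2)),
      ∫ σ, Real.exp (⟪x, totalSpin σ⟫ - n / (2 * β) * ‖x‖ ^ 2) ∂P = E ‖x‖)
    (hpol : Integrable (fun x : EuclideanSpace ℝ (Fin (k+2)) => E ‖x‖) →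
      Integrable (fun x : EuclideanSpace ℝ (Fin (k+2)) => (‖x‖ - b) ^ 2 * E ‖x‖) →
      n * (∫ x : EuclideanSpace ℝ (Fin (k+2)), (‖x‖ - b) ^ 2 * E ‖x‖)
      ≤ C * ∫ x : EuclideanSpace ℝ (Fin (k+2)), E ‖x‖) :
    n * ∫ σ, (β / n * ‖totalSpin σ‖ - b) ^ 2 * Real.exp (β / (2 * n) * ‖totalSpin σ‖ ^ 2) ∂P ≤
      (8 * β * 2 ^ (((k + 2 : ℕ) : ℝ) / 2) + 2 * C) *
        ∫ σ, Real.exp (β / (2 * n) * ‖totalSpin σ‖ ^ 2) ∂P := by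
  have hn0 : (0:ℝ) < n := by exact_mod_cast hn
  set a : ℝ := n / (2 * β) with ha
  have ha0 : 0 < a := by positivity
  set D : (Fin n → UnitSphere (k+2)) → ℝ :=
    fun σ => Real.exp (β / (2 * n) * ‖totalSpin σ‖ ^ 2) with hD
  set K : (Fin n → UnitSphere (k+2)) → EuclideanSpace ℝ (Fin (k+2)) → ℝ :=
    fun σ x => Real.exp (⟪x, totalSpin σ⟫ - a * ‖x‖ ^ 2) with hK
  have hSc := totalSpin_cont (N := k+2) (n := n)
  have hKc : Continuous (Function.uncurry K) := by
    simp only [hK, Function.uncurry_def]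
    fun_prop
  have hDc : Continuous D := by simp only [hD]; fun_prop
  have hKD : ∀ σ x, K σ x = D σ * Real.exp (-a * ‖x - (β / n) • totalSpin σ‖ ^ 2) := by
    intro σ x
    simp only [hK, hD]
    rw [← Real.exp_add]
    congr 1
    rw [norm_sub_sq_real, inner_smul_right, norm_smul, mul_pow, Real.norm_eq_abs, sq_abs]
    simp only [ha]
    field_simp
    ring
  set G : ℝ := ∫ x : EuclideanSpace ℝ (Fin (k+2)), Real.exp (-a * ‖x‖ ^ 2) with hG
  have hG0 : 0 < G := by
    rw [hG, GaussianFourier.integral_rexp_neg_mul_sq_norm ha0]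
    have := pi_pos
    positivity
  set G2 : ℝ := ∫ x : EuclideanSpace ℝ (Fin (k+2)), ‖x‖ ^ 2 * Real.exp (-a * ‖x‖ ^ 2) with hG2
  obtain ⟨hi2, hG2le⟩ := gauss_second (k+2) a ha0
  rw [← hG, ← hG2] at hG2le
  have hKi : ∀ σ, Integrable (K σ) := by
    intro σ
    simp only [funext (hKD σ)]
    exact ((gauss_integrable (k+2) a ha0).comp_sub_right ((β / n) • totalSpin σ)).const_mul _
  have hKint : ∀ σ, ∫ x, K σ x = D σ * G := by
    intro σ
    simp only [hKD σ]
    rw [integral_const_mul, integral_sub_right_eq_self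
      (fun x : EuclideanSpace ℝ (Fin (k+2)) => Real.exp (-a * ‖x‖ ^ 2))]
  have hK2i : ∀ σ, Integrable (fun x => ‖x - (β / n) • totalSpin σ‖ ^ 2 * K σ x) := by
    intro σ
    refine ((hi2.comp_sub_right ((β / n) • totalSpin σ)).const_mul (D σ)).congr
      (Filter.Eventually.of_forall fun x => ?_)
    simp only [hKD σ]; ring
  have hK2int : ∀ σ, ∫ x, ‖x - (β / n) • totalSpin σ‖ ^ 2 * K σ x = D σ * G2 := by
    intro σ
    have : ∀ x, ‖x - (β / n) • totalSpin σ‖ ^ 2 * K σ x = D σ *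
      (‖x - (β / n) • totalSpin σ‖ ^ 2 * Real.exp (-a * ‖x - (β / n) • totalSpin σ‖ ^ 2)) := by
      intro x; rw [hKD σ]; ring
    simp only [this]
    rw [integral_const_mul, integral_sub_right_eq_self
      (fun x : EuclideanSpace ℝ (Fin (k+2)) => ‖x‖ ^ 2 * Real.exp (-a * ‖x‖ ^ 2))]
  -- pointwise bound
  have hKb : ∀ σ x, K σ x ≤ Real.exp (n ^ 2 / (2 * a)) * Real.exp (-(a/2) * ‖x‖ ^ 2) := by
    intro σ x
    simp only [hK]
    rw [← Real.exp_add]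
    apply Real.exp_le_exp.2
    have h1 : ⟪x, totalSpin σ⟫ ≤ ‖x‖ * n := (real_inner_le_norm _ _).trans
      (mul_le_mul_of_nonneg_left (totalSpin_norm_le σ) (norm_nonneg _))
    have h2 : ‖x‖ * n ≤ n ^ 2 / (2 * a) + a / 2 * ‖x‖ ^ 2 := by
      have : n ^ 2 / (2 * a) + a / 2 * ‖x‖ ^ 2 - ‖x‖ * n = (n - a * ‖x‖) ^ 2 / (2 * a) := by
        field_simp; ring
      have h3 : 0 ≤ (n - a * ‖x‖) ^ 2 / (2 * a) := by positivity
      linarith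
    linarith
  have hKpos : ∀ σ x, 0 < K σ x := fun σ x => Real.exp_pos _
  have hjoint1 : Integrable (Function.uncurry K) (P.prod volume) := by
    refine integrable_joint P (a/2) (Real.exp (n ^ 2 / (2 * a))) (by positivity) _ hKc ?_
    rintro ⟨σ, x⟩
    simp only [Function.uncurry]
    rw [abs_of_pos (hKpos σ x)]
    exact hKb σ x
  have hjoint2 : Integrable (Function.uncurry fun σ x => (‖x‖ - b) ^ 2 * K σ x) (P.prod volume) := by
    refine integrable_joint P (a/4) ((8 / a + 2 * b ^ 2) * Real.exp (n ^ 2 / (2 * a)))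
      (by positivity) _ ?_ ?_
    · have : Continuous fun p : (Fin n → UnitSphere (k+2)) × EuclideanSpace ℝ (Fin (k+2)) =>
        (‖p.2‖ - b) ^ 2 * Function.uncurry K p := by fun_prop
      exact this
    rintro ⟨σ, x⟩
    simp only [Function.uncurry]
    rw [abs_of_nonneg (mul_nonneg (sq_nonneg _) (hKpos σ x).le)]
    have h1 := Real.add_one_le_exp (a / 4 * ‖x‖ ^ 2)
    have h1' : 1 ≤ Real.exp (a / 4 * ‖x‖ ^ 2) := Real.one_le_exp (by positivity)
    have h2 : ‖x‖ ^ 2 ≤ 4 / a * Real.exp (a / 4 * ‖x‖ ^ 2) := by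
      rw [div_mul_eq_mul_div, le_div_iff₀ ha0]; linarith
    have h3 : (‖x‖ - b) ^ 2 ≤ (8 / a + 2 * b ^ 2) * Real.exp (a / 4 * ‖x‖ ^ 2) := by
      have e : (8 / a + 2 * b ^ 2) * Real.exp (a / 4 * ‖x‖ ^ 2) =
        2 * (4 / a * Real.exp (a / 4 * ‖x‖ ^ 2)) + 2 * b ^ 2 * Real.exp (a / 4 * ‖x‖ ^ 2) := by ring
      rw [e]
      nlinarith [sq_nonneg (‖x‖ + b), sq_nonneg b,
        mul_le_mul_of_nonneg_left h1' (show 0 ≤ 2 * b ^ 2 by positivity)]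
    calc _ ≤ ((8 / a + 2 * b ^ 2) * Real.exp (a / 4 * ‖x‖ ^ 2)) *
          (Real.exp (n ^ 2 / (2 * a)) * Real.exp (-(a/2) * ‖x‖ ^ 2)) :=
          mul_le_mul h3 (hKb σ x) (hKpos σ x).le (by positivity)
      _ = (8 / a + 2 * b ^ 2) * Real.exp (n ^ 2 / (2 * a)) *
          (Real.exp (a / 4 * ‖x‖ ^ 2) * Real.exp (-(a/2) * ‖x‖ ^ 2)) := by ring
      _ = _ := by rw [← Real.exp_add]; congr 2; ring
  -- Fubini
  have hE' : ∀ x, ∫ σ, K σ x ∂P = E ‖x‖ := hE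
  have hE2 : ∀ x, ∫ σ, (‖x‖ - b) ^ 2 * K σ x ∂P = (‖x‖ - b) ^ 2 * E ‖x‖ := by
    intro x; rw [integral_const_mul, hE']
  have hF1 : ∫ x : EuclideanSpace ℝ (Fin (k+2)), E ‖x‖ = G * ∫ σ, D σ ∂P := by
    rw [← integral_const_mul]
    simp only [← hE']
    rw [← integral_integral_swap hjoint1]
    congr 1; ext σ; rw [hKint]; ring
  have hF2 : ∫ x : EuclideanSpace ℝ (Fin (k+2)), (‖x‖ - b) ^ 2 * E ‖x‖ =
      ∫ σ, (∫ x : EuclideanSpace ℝ (Fin (k+2)), (‖x‖ - b) ^ 2 * K σ x) ∂P := by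
    simp only [← hE2]
    rw [integral_integral_swap hjoint2]
  have hI1 : Integrable (fun x : EuclideanSpace ℝ (Fin (k+2)) => E ‖x‖) := by
    have := hjoint1.integral_prod_right
    simpa only [Function.uncurry, hE'] using this
  have hI2 : Integrable (fun x : EuclideanSpace ℝ (Fin (k+2)) => (‖x‖ - b) ^ 2 * E ‖x‖) := by
    have := hjoint2.integral_prod_right
    simpa only [Function.uncurry, hE2] using this
  have hmain := hpol hI1 hI2
  have hJi : Integrable (fun σ => ∫ x, (‖x‖ - b) ^ 2 * K σ x) P := hjoint2.integral_prod_left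
  have hbd : ∀ f : (Fin n → UnitSphere (k+2)) → ℝ, Continuous f → Integrable f P := by
    intro f hf
    obtain ⟨c, hc⟩ := isCompact_univ.exists_bound_of_continuousOn (hf.continuousOn (s := Set.univ))
    exact Integrable.of_bound hf.aestronglyMeasurable c
      (Filter.Eventually.of_forall fun x => hc x trivial)
  have hsig : ∀ σ, G * ((β / n * ‖totalSpin σ‖ - b) ^ 2 * D σ) ≤
      2 * G2 * D σ + 2 * ∫ x, (‖x‖ - b) ^ 2 * K σ x := by
    intro σ
    have hKbi : Integrable (fun x => (‖x‖ - b) ^ 2 * K σ x) := by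
      refine ((hK2i σ).const_mul 2 |>.add ((hKi σ).const_mul
        (2 * (β / n * ‖totalSpin σ‖ - b) ^ 2))).mono' ?_ (Filter.Eventually.of_forall fun x => ?_)
      · have h1 : Continuous (K σ) := by simp only [hK]; fun_prop
        have : Continuous fun x => (‖x‖ - b) ^ 2 * K σ x := by fun_prop
        exact this.aestronglyMeasurable
      · rw [Real.norm_of_nonneg (mul_nonneg (sq_nonneg _) (hKpos σ x).le)]
        have h1 := abs_norm_sub_norm_le x ((β / n) • totalSpin σ)
        rw [norm_smul, Real.norm_of_nonneg (by positivity)] at h1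
        have h2 := pow_le_pow_left₀ (abs_nonneg _) h1 2
        rw [sq_abs] at h2
        have h3 : (‖x‖ - b) ^ 2 ≤ 2 * ‖x - (β / n) • totalSpin σ‖ ^ 2
          + 2 * (β / n * ‖totalSpin σ‖ - b) ^ 2 := by
          nlinarith [sq_nonneg ((‖x‖ - β / n * ‖totalSpin σ‖) - (β / n * ‖totalSpin σ‖ - b))]
        have h4 := mul_le_mul_of_nonneg_right h3 (hKpos σ x).le
        simp only [Pi.add_apply]
        linarith
    have hle : ∫ x, (β / n * ‖totalSpin σ‖ - b) ^ 2 * K σ x ≤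
        ∫ x, (2 * (‖x - (β / n) • totalSpin σ‖ ^ 2 * K σ x) + 2 * ((‖x‖ - b) ^ 2 * K σ x)) := by
      apply integral_mono ((hKi σ).const_mul _) (((hK2i σ).const_mul 2).add (hKbi.const_mul 2))
      intro x
      have h1 := abs_norm_sub_norm_le x ((β / n) • totalSpin σ)
      rw [norm_smul, Real.norm_of_nonneg (by positivity)] at h1
      have h2 := pow_le_pow_left₀ (abs_nonneg _) h1 2
      rw [sq_abs] at h2
      have h3 : (β / n * ‖totalSpin σ‖ - b) ^ 2 ≤ 2 * ‖x - (β / n) • totalSpin σ‖ ^ 2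
          + 2 * (‖x‖ - b) ^ 2 := by
        nlinarith [sq_nonneg ((‖x‖ - β / n * ‖totalSpin σ‖) + (‖x‖ - b))]
      have h4 := mul_le_mul_of_nonneg_right h3 (hKpos σ x).le
      simp only [Pi.add_apply]
      linarith
    rw [integral_add ((hK2i σ).const_mul 2) (hKbi.const_mul 2), integral_const_mul,
      integral_const_mul, integral_const_mul, hKint, hK2int] at hle
    linarith
  have hint := integral_mono (μ := P) ((hbd (fun σ => (β / n * ‖totalSpin σ‖ - b) ^ 2 * D σ)
    (by fun_prop)).const_mul G) (((hbd D hDc).const_mul (2 * G2)).add (hJi.const_mul 2)) hsig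
  simp only [Pi.add_apply] at hint
  rw [integral_add ((hbd D hDc).const_mul (2 * G2)) (hJi.const_mul 2), integral_const_mul,
    integral_const_mul, integral_const_mul, ← hF2] at hint
  rw [hF1] at hmain
  set I := ∫ σ, (β / n * ‖totalSpin σ‖ - b) ^ 2 * D σ ∂P with hI
  set Z := ∫ σ, D σ ∂P with hZ
  set Q := ∫ x : EuclideanSpace ℝ (Fin (k+2)), (‖x‖ - b) ^ 2 * E ‖x‖ with hQ
  have hZ0 : 0 ≤ Z := integral_nonneg fun σ => (Real.exp_pos _).le
  set t : ℝ := 2 ^ (((k + 2 : ℕ) : ℝ) / 2) with ht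
  have hna : n * (2 / a) = 4 * β := by simp only [ha]; field_simp; norm_num
  have h1 : n * G2 ≤ 4 * β * t * G := by
    calc n * G2 ≤ n * (2 / a * t * G) := mul_le_mul_of_nonneg_left hG2le hn0.le
      _ = (n * (2 / a)) * t * G := by ring
      _ = _ := by rw [hna]
  have h2 := mul_le_mul_of_nonneg_right h1 hZ0
  have h3 := mul_le_mul_of_nonneg_left hint hn0.le
  have h4 : G * (n * I) ≤ G * ((8 * β * t + 2 * C) * Z) := by nlinarith
  exact le_of_mul_le_mul_left h4 hG0

noncomputable section

/-- The second moment of `W_n` under the Gibbs measure is bounded uniformly in `n`. -/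
theorem Wspin_second_moment_bound (N : ℕ) (hN : 2 ≤ N)
    (μ : Measure (UnitSphere N)) [IsProbabilityMeasure μ]
    (hμinv : ∀ e : EuclideanSpace ℝ (Fin N) ≃ₗᵢ[ℝ] EuclideanSpace ℝ (Fin N),
      Measure.map (sphereMap e) μ = μ)
    (β : ℝ) (hβ : (N : ℝ) < β)
    (b : ℝ) (hb : 0 < b) (hbfix : b = β * besselRatio N b) :
    ∃ C > 0, ∀ n : ℕ, 1 ≤ n →
      (∫ σ, Wspin N n β b σ ^ 2 ∂(gibbsMeasure N n β μ)) ≤ C := by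
  obtain ⟨k, rfl⟩ : ∃ k, N = k + 2 := ⟨N - 2, by omega⟩
  have hβ0 : 0 < β := lt_of_le_of_lt (Nat.cast_nonneg _) hβ
  have hd0 : ∀ r, HasDerivAt (mom μ 0 0) (mom μ 0 1 r) r := fun r => mom_hasDerivAt μ 0 0 r
  have hd1 : ∀ r, HasDerivAt (mom μ 0 1) (mom μ 0 2 r) r := fun r => mom_hasDerivAt μ 0 1 r
  obtain ⟨c, hc, hrate⟩ := rate_bound k (mom μ 0 0) (mom μ 0 1) (mom μ 0 2) hd0 hd1
    (fun r hr => mom_ode k μ hμinv 0 r hr) (mom_zero_pos μ 0) β b hβ0 hb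
    (mom_fix k μ hμinv 0 β b hb hbfix)
  obtain ⟨C0, hC0, hrad⟩ := radial_bound k (mom μ 0 0) (mom μ 0 1) (mom μ 0 2) hd0 hd1
    (mom_zero_pos μ 0) β b hb c hc hrate
  refine ⟨(β / b + 1) ^ 2 / b ^ 2 * (8 * β * 2 ^ (((k + 2 : ℕ) : ℝ) / 2) + 2 * C0),
    by positivity, fun n hn => ?_⟩
  have hn0 : (0:ℝ) < n := by exact_mod_cast hn
  set P : Measure (Fin n → UnitSphere (k+2)) := Measure.pi fun _ : Fin n => μ with hP
  have hE : ∀ x : EuclideanSpace ℝ (Fin (k+2)),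
      ∫ σ, Real.exp (⟪x, totalSpin σ⟫ - n / (2 * β) * ‖x‖ ^ 2) ∂P =
      (fun r => Real.exp (-(n * r ^ 2 / (2 * β))) * mom μ 0 0 r ^ n) ‖x‖ := by
    intro x
    have h1 : ∀ σ : Fin n → UnitSphere (k+2),
        Real.exp (⟪x, totalSpin σ⟫ - n / (2 * β) * ‖x‖ ^ 2) =
        Real.exp (-(n * ‖x‖ ^ 2 / (2 * β))) * ∏ i, Real.exp ⟪x, (σ i).1⟫ := by
      intro σ
      rw [← Real.exp_sum, ← Real.exp_add, totalSpin, inner_sum]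
      congr 1; ring
    simp only [h1]
    rw [integral_const_mul, hP,
      integral_fintype_prod_eq_pow (fun s : UnitSphere (k+2) => Real.exp ⟪x, s.1⟫),
      radial μ hμinv 0 x, Fintype.card_fin]
  have hmain := HS_bound k n hn P β b C0 hβ0 _ hE
    (fun h1 h2 => polar_bound k _ b C0 n h1 h2 (hrad n hn))
  have hSc : Continuous (totalSpin : (Fin n → UnitSphere (k+2)) → _) := totalSpin_cont
  have hbd : ∀ f : (Fin n → UnitSphere (k+2)) → ℝ, Continuous f → Integrable f P := by
    intro f hf
    obtain ⟨c, hc⟩ := isCompact_univ.exists_bound_of_continuousOn (hf.continuousOn (s := Set.univ))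
    exact Integrable.of_bound hf.aestronglyMeasurable c
      (Filter.Eventually.of_forall fun x => hc x trivial)
  set D : (Fin n → UnitSphere (k+2)) → ℝ :=
    fun σ => Real.exp (β / (2 * n) * ‖totalSpin σ‖ ^ 2) with hD
  have hDc : Continuous D := by simp only [hD]; fun_prop
  have hDpos : ∀ σ, 0 < D σ := fun σ => Real.exp_pos _
  have hZ : 0 < ∫ σ, D σ ∂P := integral_exp_pos (hbd D hDc)
  have hw : gibbsWeight (k+2) n β = D := funext fun σ => gibbsWeight_eq β σ
  rw [gibbsMeasure, ← hP, hw]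
  set Z := ∫ σ, D σ ∂P with hZd
  have hmeas : Measurable fun σ => ENNReal.ofReal (D σ / Z) :=
    (hDc.measurable.div_const Z).ennreal_ofReal
  rw [integral_withDensity_eq_integral_toReal_smul hmeas
    (Filter.Eventually.of_forall fun σ => ENNReal.ofReal_lt_top)]
  have hpt : ∀ σ : Fin n → UnitSphere (k+2),
      (ENNReal.ofReal (D σ / Z)).toReal • Wspin (k+2) n β b σ ^ 2 ≤
      ((β / b + 1) ^ 2 / b ^ 2 / Z * n) * ((β / n * ‖totalSpin σ‖ - b) ^ 2 * D σ) := by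
    intro σ
    rw [ENNReal.toReal_ofReal (div_nonneg (hDpos σ).le hZ.le), smul_eq_mul]
    have hs : β / n * ‖totalSpin σ‖ ≤ β := by
      calc β / n * ‖totalSpin σ‖ ≤ β / n * n :=
            mul_le_mul_of_nonneg_left (totalSpin_norm_le σ) (by positivity)
        _ = β := by field_simp
    have hs0 : 0 ≤ β / n * ‖totalSpin σ‖ := by positivity
    have hW : Wspin (k+2) n β b σ ^ 2 =
        n * ((β / n * ‖totalSpin σ‖ - b) ^ 2 / b ^ 2 * (β / n * ‖totalSpin σ‖ / b + 1) ^ 2) := by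
      rw [Wspin, mul_pow, Real.sq_sqrt hn0.le]
      congr 1
      field_simp
      ring
    have h1 : (β / n * ‖totalSpin σ‖ / b + 1) ^ 2 ≤ (β / b + 1) ^ 2 := by
      gcongr
    rw [hW]
    calc _ ≤ D σ / Z * (n * ((β / n * ‖totalSpin σ‖ - b) ^ 2 / b ^ 2 * (β / b + 1) ^ 2)) := by
          have := hDpos σ
          gcongr
      _ = _ := by ring
  have hfc : Continuous fun σ : Fin n → UnitSphere (k+2) =>
      (β / n * ‖totalSpin σ‖ - b) ^ 2 * D σ := by fun_prop
  have hstep : ∫ σ, (ENNReal.ofReal (D σ / Z)).toReal • Wspin (k+2) n β b σ ^ 2 ∂P ≤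
      ∫ σ, ((β / b + 1) ^ 2 / b ^ 2 / Z * n) * ((β / n * ‖totalSpin σ‖ - b) ^ 2 * D σ) ∂P := by
    apply integral_mono_of_nonneg (Filter.Eventually.of_forall fun σ => ?_)
      ((hbd _ hfc).const_mul _) (Filter.Eventually.of_forall hpt)
    exact smul_nonneg ENNReal.toReal_nonneg (sq_nonneg _)
  refine hstep.trans ?_
  rw [integral_const_mul, mul_assoc]
  calc _ ≤ (β / b + 1) ^ 2 / b ^ 2 / Z *
        ((8 * β * 2 ^ (((k + 2 : ℕ) : ℝ) / 2) + 2 * C0) * Z) :=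
        mul_le_mul_of_nonneg_left hmain (by positivity)
    _ = _ := by field_simp

end
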